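/- arXiv:1712.06656 — 2 statements merged into one kernel-verified Lean document; each statement's English description precedes it below -/
import Mathlib

section
/- There is a constant K₀ (one may take K₀ = 512) such that for every real number k ≥ K₀ and every real number x whose distance from 1/4 + ℤ and from −1/4 + ℤ is at least 2/k^{1/3}, one has |2 + 2πk·cos(2πx)| ≥ 4·k^{2/3}. -/
open Real

/-- The distance from `x` to `1/4 + (1/2)ℤ` bounds `|cos (2πx)|` from below, by concavity. -/
lemma four_mul_le_abs_cos_two_pi_mul (x d : ℝ)
    (h₁ : ∀ n : ℤ, d ≤ |x - (1 / 4 + n)|)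
    (h₂ : ∀ n : ℤ, d ≤ |x - (-(1 / 4) + n)|) :
    4 * d ≤ |cos (2 * π * x)| := by
  obtain ⟨m, hm⟩ : ∃ m : ℤ, |2 * x - m| ≤ 1 / 2 := ⟨_, abs_sub_round (2 * x)⟩
  have hd : d ≤ |x - (m / 2 + 1 / 4)| ∧ d ≤ |x - (m / 2 - 1 / 4)| := by
    obtain ⟨n, rfl | rfl⟩ := Int.even_or_odd' m
    · constructor
      · convert h₁ n using 3
        push_cast
        ring
      · convert h₂ n using 3
        push_cast
        ring
    · constructor
      · convert h₂ (n + 1) using 3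
        push_cast
        ring
      · convert h₁ n using 3
        push_cast
        ring
  obtain ⟨y, hy⟩ : ∃ y : ℝ, y = 2 * x - m := ⟨_, rfl⟩
  rw [← hy] at hm
  have hm' := abs_le.mp hm
  have hyd : 4 * d ≤ 1 - 2 * |y| := by
    obtain ⟨hp, hn⟩ := hd
    rw [abs_of_nonpos (by linarith)] at hp
    rw [abs_of_nonneg (by linarith)] at hn
    cases abs_cases y <;> linarith
  have hcos : |cos (2 * π * x)| = |cos (π * |y|)| := by
    have h : 2 * π * x = π * y + m * π := by rw [hy]; ring
    rw [h, cos_add_int_mul_pi, abs_mul, abs_neg_one_zpow, one_mul, ← cos_abs (π * y), abs_mul,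
      abs_of_pos pi_pos]
  have hsin := mul_le_sin (x := π / 2 - π * |y|) (by nlinarith [pi_pos])
    (by nlinarith [pi_pos, abs_nonneg y])
  rw [sin_pi_div_two_sub] at hsin
  have h : 2 / π * (π / 2 - π * |y|) = 1 - 2 * |y| := by
    field_simp
  rw [hcos]
  linarith [le_abs_self (cos (π * |y|))]

/-- For `k ≥ 512` and any `x` whose distance from `1/4 + ℤ` and from `−1/4 + ℤ`
is at least `2/k^(1/3)`, one has `|2 + 2πk cos(2πx)| ≥ 4 k^(2/3)`. -/
theorem stmt_11 (k : ℝ) (hk : (512 : ℝ) ≤ k) (x : ℝ)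
    (h₁ : ∀ n : ℤ, 2 / k ^ ((1 : ℝ) / 3) ≤ |x - (1 / 4 + n)|)
    (h₂ : ∀ n : ℤ, 2 / k ^ ((1 : ℝ) / 3) ≤ |x - (-(1 / 4) + n)|) :
    4 * k ^ ((2 : ℝ) / 3) ≤ |2 + 2 * Real.pi * k * Real.cos (2 * Real.pi * x)| := by
  have hcos := four_mul_le_abs_cos_two_pi_mul x _ h₁ h₂
  have hk0 : 0 < k := by linarith
  obtain ⟨c, hc⟩ : ∃ c : ℝ, c = k ^ ((1 : ℝ) / 3) := ⟨_, rfl⟩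
  have hc1 : 1 ≤ c := hc ▸ one_le_rpow (by linarith) (by norm_num)
  have hc2 : k ^ ((2 : ℝ) / 3) = c ^ 2 := by
    rw [hc, ← rpow_mul_natCast hk0.le]
    norm_num
  have hc3 : k = c ^ 3 := by
    rw [hc, ← rpow_mul_natCast hk0.le]
    norm_num
  rw [← hc] at hcos
  rw [hc2]
  have hmain : 16 * π * c ^ 2 ≤ |2 * π * k * cos (2 * π * x)| := by
    rw [abs_mul, abs_of_pos (by positivity : 0 < 2 * π * k)]
    calc 16 * π * c ^ 2 = 2 * π * k * (4 * (2 / c)) := by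
          rw [hc3]
          field_simp
          norm_num
      _ ≤ _ := by gcongr
  have htri := abs_sub_abs_le_abs_sub (2 * π * k * cos (2 * π * x)) (-2)
  rw [sub_neg_eq_add, add_comm _ (2 : ℝ), abs_neg, abs_two] at htri
  nlinarith [pi_gt_three]
end

section
/- There exists a unique real number κ > 0 satisfying (1/16)^κ + (1/8)^κ + (1/8)^κ = (71/96)^κ, and this κ satisfies 0.554 < κ < 0.555. -/
open Real

/-- Dividing Bowen's equation by `(71/96)^κ` gives `(6/71)^κ + 2 (12/71)^κ = 1`. -/
theorem bowen_equation_iff_normalized (x : ℝ) :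
    (1 / 16 : ℝ) ^ x + (1 / 8 : ℝ) ^ x + (1 / 8 : ℝ) ^ x = (71 / 96 : ℝ) ^ x ↔
      (6 / 71 : ℝ) ^ x + 2 * (12 / 71 : ℝ) ^ x = 1 := by
  have h₁ : (1 / 16 : ℝ) ^ x = (6 / 71 : ℝ) ^ x * (71 / 96 : ℝ) ^ x := by
    rw [← mul_rpow (by norm_num) (by norm_num)]; norm_num
  have h₂ : (1 / 8 : ℝ) ^ x = (12 / 71 : ℝ) ^ x * (71 / 96 : ℝ) ^ x := by
    rw [← mul_rpow (by norm_num) (by norm_num)]; norm_num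
  have hL : (71 / 96 : ℝ) ^ x ≠ 0 := (rpow_pos_of_pos (by norm_num) x).ne'
  rw [h₁, h₂, ← add_mul, ← add_mul, mul_eq_right₀ hL, two_mul, add_assoc]

theorem strictAnti_rpow_add_two_mul_rpow {a b : ℝ} (ha₀ : 0 < a) (ha₁ : a < 1)
    (hb₀ : 0 < b) (hb₁ : b < 1) : StrictAnti fun x : ℝ => a ^ x + 2 * b ^ x := by
  intro x y hxy
  have h₁ := rpow_lt_rpow_of_exponent_gt ha₀ ha₁ hxy
  have h₂ := rpow_lt_rpow_of_exponent_gt hb₀ hb₁ hxy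
  dsimp only
  linarith

theorem lt_rpow_div_of_pow_lt_pow {a p : ℝ} {m n : ℕ} (ha : 0 ≤ a) (hn : n ≠ 0)
    (h : p ^ n < a ^ m) : p < a ^ ((m : ℝ) / n) := by
  refine lt_of_pow_lt_pow_left₀ n (rpow_nonneg ha _) ?_
  rwa [← rpow_mul_natCast ha, div_mul_cancel₀ _ (Nat.cast_ne_zero.2 hn), rpow_natCast]

theorem rpow_div_lt_of_pow_lt_pow {a p : ℝ} {m n : ℕ} (ha : 0 ≤ a) (hp : 0 ≤ p) (hn : n ≠ 0)
    (h : a ^ m < p ^ n) : a ^ ((m : ℝ) / n) < p := by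
  refine lt_of_pow_lt_pow_left₀ n hp ?_
  rwa [← rpow_mul_natCast ha, div_mul_cancel₀ _ (Nat.cast_ne_zero.2 hn), rpow_natCast]

/-- There is a unique `κ > 0` with `(1/16)^κ + (1/8)^κ + (1/8)^κ = (71/96)^κ`,
and it satisfies `0.554 < κ < 0.555`. -/
theorem stmt_14 :
    ∃ κ : ℝ,
      (0 < κ ∧
        (1 / 16 : ℝ) ^ κ + (1 / 8 : ℝ) ^ κ + (1 / 8 : ℝ) ^ κ = (71 / 96 : ℝ) ^ κ) ∧
      (∀ κ' : ℝ,
        0 < κ' ∧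
          (1 / 16 : ℝ) ^ κ' + (1 / 8 : ℝ) ^ κ' + (1 / 8 : ℝ) ^ κ' = (71 / 96 : ℝ) ^ κ' →
            κ' = κ) ∧
      0.554 < κ ∧ κ < 0.555 := by
  simp only [bowen_equation_iff_normalized]
  have hanti : StrictAnti fun x : ℝ => (6 / 71 : ℝ) ^ x + 2 * (12 / 71 : ℝ) ^ x :=
    strictAnti_rpow_add_two_mul_rpow (by norm_num) (by norm_num) (by norm_num) (by norm_num)
  have hcont : Continuous fun x : ℝ => (6 / 71 : ℝ) ^ x + 2 * (12 / 71 : ℝ) ^ x :=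
    (continuous_const_rpow (by norm_num)).add
      ((continuous_const_rpow (by norm_num)).const_mul 2)
  have hlow : 1 < (6 / 71 : ℝ) ^ ((41 : ℕ) / (74 : ℕ) : ℝ) +
      2 * (12 / 71 : ℝ) ^ ((41 : ℕ) / (74 : ℕ) : ℝ) := by
    have h₁ : (2543 / 10000 : ℝ) < (6 / 71 : ℝ) ^ ((41 : ℕ) / (74 : ℕ) : ℝ) :=
      lt_rpow_div_of_pow_lt_pow (by norm_num) (by norm_num) (by norm_num)
    have h₂ : (3734 / 10000 : ℝ) < (12 / 71 : ℝ) ^ ((41 : ℕ) / (74 : ℕ) : ℝ) :=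
      lt_rpow_div_of_pow_lt_pow (by norm_num) (by norm_num) (by norm_num)
    linarith
  have hupp : (6 / 71 : ℝ) ^ ((111 : ℕ) / (200 : ℕ) : ℝ) +
      2 * (12 / 71 : ℝ) ^ ((111 : ℕ) / (200 : ℕ) : ℝ) < 1 := by
    have h₁ : (6 / 71 : ℝ) ^ ((111 : ℕ) / (200 : ℕ) : ℝ) < 2538 / 10000 :=
      rpow_div_lt_of_pow_lt_pow (by norm_num) (by norm_num) (by norm_num) (by norm_num)
    have h₂ : (12 / 71 : ℝ) ^ ((111 : ℕ) / (200 : ℕ) : ℝ) < 3729 / 10000 :=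
      rpow_div_lt_of_pow_lt_pow (by norm_num) (by norm_num) (by norm_num) (by norm_num)
    linarith
  obtain ⟨κ, ⟨hκ₁, hκ₂⟩, hκ⟩ :=
    intermediate_value_Ioo' (a := ((41 : ℕ) / (74 : ℕ) : ℝ)) (b := ((111 : ℕ) / (200 : ℕ) : ℝ))
      (by norm_num) hcont.continuousOn ⟨hupp, hlow⟩
  norm_num at hκ₁ hκ₂
  refine ⟨κ, ⟨by linarith, hκ⟩, fun y hy => hanti.injective (hy.2.trans hκ.symm), ?_, ?_⟩
  · linarith
  · linarith
end
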